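/- arXiv:1802.09205 — 2 statements merged into one kernel-verified Lean document; each statement's English description precedes it below -/
import Mathlib

section
/- Let S be a finite set of points in a metric space, let O be a set of k points of the metric space, let Z ⊆ S with |Z| = z, and let r ≥ 0 be such that every s ∈ S ∖ Z satisfies d(s, O) ≤ r. Let z' be a nonnegative integer and let X ⊆ S be a nonempty subset with |X ∩ Z| ≤ z' and k + z' ≤ |X|. Then the set T consisting of the first k + z' points of any greedy (GMM) sequence in X satisfies r_T(X) ≤ 2r. -/
/-- Distance-based radius of a finite set `S` with respect to a finite set
of centers `T`: `r_T(S) = max_{s ∈ S} d(s, T)`. -/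
noncomputable def radius {α : Type*} [MetricSpace α] (S T : Finset α) : ℝ :=
  sSup ((fun s => Metric.infDist s (T : Set α)) '' (S : Set α))

/-- Optimal radius of the `k`-center problem on `S`. -/
noncomputable def optRadius {α : Type*} [MetricSpace α] (S : Finset α) (k : ℕ) : ℝ :=
  sInf ((fun T => radius S T) '' {T : Finset α | T ⊆ S ∧ T.card = k})

/-- Optimal radius of the `k`-center problem with `z` outliers on `S`. -/
noncomputable def optRadiusOut {α : Type*} [MetricSpace α] [DecidableEq α]
    (S : Finset α) (k z : ℕ) : ℝ :=
  sInf {r : ℝ | ∃ T Z : Finset α, T ⊆ S ∧ T.card = k ∧ Z ⊆ S ∧ Z.card = z ∧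
    radius (S \ Z) T = r}

/-- `t : ℕ → α` is a greedy (GMM) sequence in the finite set `X`: `t 0 ∈ X` and
each `t (j+1)` is a point of `X` at maximum distance from `{t 0, …, t j}`. -/
def IsGMM {α : Type*} [MetricSpace α] [DecidableEq α] (X : Finset α) (t : ℕ → α) : Prop :=
  t 0 ∈ X ∧ ∀ j : ℕ, t (j + 1) ∈ X ∧ ∀ x ∈ X,
    Metric.infDist x (((Finset.range (j + 1)).image t : Finset α) : Set α) ≤
      Metric.infDist (t (j + 1)) (((Finset.range (j + 1)).image t : Finset α) : Set α)

/-- A metric space has doubling dimension at most `D` if every closed ball of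
radius `r` is covered by at most `2^D` closed balls of radius `r/2`. -/
def DoublingDimLE (α : Type*) [MetricSpace α] (D : ℕ) : Prop :=
  ∀ (x : α) (r : ℝ), 0 < r → ∃ Y : Finset α, Y.card ≤ 2 ^ D ∧
    Metric.closedBall x r ⊆ ⋃ y ∈ Y, Metric.closedBall y (r / 2)

/-- A `2r`-separated set all of whose points are within `r` of a finite nonempty set `O` has at
most as many points as `O`. -/
theorem card_le_card_of_pairwise_two_mul_lt_dist {α : Type*} [MetricSpace α]
    {P O : Finset α} {r : ℝ} (hO : O.Nonempty)
    (hcov : ∀ p ∈ P, Metric.infDist p (O : Set α) ≤ r)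
    (hsep : (P : Set α).Pairwise fun p q => 2 * r < dist p q) : P.card ≤ O.card := by
  have hnear : ∀ p ∈ P, ∃ o ∈ O, dist p o ≤ r := fun p hp => by
    obtain ⟨o, ho, hpo⟩ :=
      O.finite_toSet.isCompact.exists_infDist_eq_dist (Finset.coe_nonempty.2 hO) p
    exact ⟨o, ho, hpo ▸ hcov p hp⟩
  by_contra! hlt
  choose! f hfO hfr using hnear
  obtain ⟨p, hp, q, hq, hpq, hf⟩ := Finset.exists_ne_map_eq_of_card_lt_of_maps_to hlt hfO
  have hq' := hfr q hq
  rw [← hf] at hq'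
  linarith [hsep hp hq hpq, hfr p hp, dist_triangle_right p q (f p)]

theorem IsGMM.mem {α : Type*} [MetricSpace α] [DecidableEq α] {X : Finset α} {t : ℕ → α}
    (ht : IsGMM X t) : ∀ j, t j ∈ X
  | 0 => ht.1
  | j + 1 => (ht.2 j).1

/-- The first `n` greedy centers are pairwise at least as far apart as any point of `X` is from
all of them. -/
theorem IsGMM.infDist_le_dist {α : Type*} [MetricSpace α] [DecidableEq α] {X : Finset α}
    {t : ℕ → α} (ht : IsGMM X t) {x : α} (hx : x ∈ X) {n i j : ℕ} (hij : i < j) (hj : j < n) :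
    Metric.infDist x (((Finset.range n).image t : Finset α) : Set α) ≤ dist (t i) (t j) := by
  obtain ⟨m, rfl⟩ : ∃ m, j = m + 1 := ⟨j - 1, by omega⟩
  calc Metric.infDist x (((Finset.range n).image t : Finset α) : Set α)
      ≤ Metric.infDist x (((Finset.range (m + 1)).image t : Finset α) : Set α) :=
        Metric.infDist_le_infDist_of_subset
          (Finset.coe_subset.2 (Finset.image_subset_image (Finset.range_subset_range.2 hj.le)))
          ⟨t 0, by simpa using ⟨0, by omega, rfl⟩⟩
    _ ≤ Metric.infDist (t (m + 1)) (((Finset.range (m + 1)).image t : Finset α) : Set α) :=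
        (ht.2 m).2 x hx
    _ ≤ dist (t (m + 1)) (t i) :=
        Metric.infDist_le_dist_of_mem
          (Finset.mem_coe.2 (Finset.mem_image_of_mem t (Finset.mem_range.2 hij)))
    _ = dist (t i) (t (m + 1)) := dist_comm _ _

/-- if every non-outlier point of `S` is within `r` of a set `O`
of `k` centers, and `X ⊆ S` contains at most `z'` outliers, then the first
`k + z'` GMM centers of `X` achieve radius at most `2r` on `X`. -/
theorem gmm_random_partition_radius {α : Type*} [MetricSpace α] [DecidableEq α]
    (S : Finset α) (hS : S.Nonempty)
    (k : ℕ) (hk : 0 < k) (O : Finset α) (hO : O.card = k)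
    (z : ℕ) (Z : Finset α) (hZS : Z ⊆ S) (hZ : Z.card = z)
    (r : ℝ) (hr : 0 ≤ r)
    (hcov : ∀ s ∈ S \ Z, Metric.infDist s (O : Set α) ≤ r)
    (z' : ℕ) (X : Finset α) (hXS : X ⊆ S) (hXne : X.Nonempty)
    (hXZ : (X ∩ Z).card ≤ z') (hcard : k + z' ≤ X.card)
    (t : ℕ → α) (ht : IsGMM X t) :
    radius X ((Finset.range (k + z')).image t) ≤ 2 * r := by
  refine csSup_le (hXne.to_set.image _) ?_
  rintro _ ⟨x, hx, rfl⟩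
  by_contra! hfar
  set T := (Finset.range (k + z')).image t
  have hlt : ∀ {i j : ℕ}, i < j → j < k + z' → 2 * r < dist (t i) (t j) := fun hij hj =>
    hfar.trans_le (ht.infDist_le_dist hx hij hj)
  have hxT : ∀ y ∈ T, 2 * r < dist x y := fun y hy =>
    hfar.trans_le (Metric.infDist_le_dist_of_mem hy)
  have hTcard : T.card = k + z' := by
    rw [Finset.card_image_of_injOn, Finset.card_range]
    intro i hi j hj hij
    simp only [Finset.coe_range, Set.mem_Iio] at hi hj
    by_contra hne
    rcases lt_or_gt_of_ne hne with h | h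
    · have := hlt h hj
      rw [hij, dist_self] at this
      linarith
    · have := hlt h hi
      rw [hij, dist_self] at this
      linarith
  have hxnotin : x ∉ T := fun h => by
    have := hxT x h
    rw [dist_self] at this
    linarith
  have hTsep : (T : Set α).Pairwise fun p q => 2 * r < dist p q := by
    intro p hp q hq hpq
    obtain ⟨i, hi, rfl⟩ := Finset.mem_image.1 hp
    obtain ⟨j, hj, rfl⟩ := Finset.mem_image.1 hq
    rcases lt_or_gt_of_ne (ne_of_apply_ne t hpq) with h | h
    · exact hlt h (Finset.mem_range.1 hj)
    · rw [dist_comm]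
      exact hlt h (Finset.mem_range.1 hi)
  have hsep : ((insert x T : Finset α) : Set α).Pairwise fun p q => 2 * r < dist p q := by
    rw [Finset.coe_insert]
    exact hTsep.insert fun y hy _ => ⟨hxT y hy, dist_comm x y ▸ hxT y hy⟩
  have hsub : insert x T ⊆ X :=
    Finset.insert_subset hx (Finset.image_subset_iff.2 fun j _ => ht.mem j)
  have hle : (insert x T \ Z).card ≤ O.card :=
    card_le_card_of_pairwise_two_mul_lt_dist (Finset.card_pos.1 (hO ▸ hk))
      (fun p hp => hcov p (Finset.sdiff_subset_sdiff (hsub.trans hXS) le_rfl hp))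
      (hsep.mono (Finset.coe_subset.2 Finset.sdiff_subset))
  have hout : (insert x T ∩ Z).card ≤ z' :=
    (Finset.card_le_card (Finset.inter_subset_inter_right hsub)).trans hXZ
  have hsplit := Finset.card_sdiff_add_card_inter (insert x T) Z
  rw [Finset.card_insert_of_notMem hxnotin] at hsplit
  omega
end

section
/- Let M be a metric space of doubling dimension at most D, let S be a finite set of points of M, let k, z be positive integers with k + z < |S|, and let 0 < ε̂ ≤ 1. Let τ be any integer with (k + z) · 2^{D·⌈log₂(16/ε̂)⌉} ≤ τ < |S|. Then r_τ^*(S) ≤ (ε̂/8) · r_{k+z}^*(S); consequently r_τ^*(S) ≤ (ε̂/8) · r_{k,z}^*(S). -/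
theorem radius_nonneg {α : Type*} [MetricSpace α] (S T : Finset α) : 0 ≤ radius S T := by
  refine Real.sSup_nonneg ?_
  rintro _ ⟨s, -, rfl⟩
  exact Metric.infDist_nonneg

theorem radius_le {α : Type*} [MetricSpace α] {S T : Finset α} {r : ℝ} (hr : 0 ≤ r)
    (h : ∀ s ∈ S, Metric.infDist s (T : Set α) ≤ r) : radius S T ≤ r := by
  refine Real.sSup_le ?_ hr
  rintro _ ⟨s, hs, rfl⟩
  exact h s hs

theorem infDist_le_radius {α : Type*} [MetricSpace α] {S : Finset α} (T : Finset α) {s : α}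
    (hs : s ∈ S) : Metric.infDist s (T : Set α) ≤ radius S T :=
  le_csSup (S.finite_toSet.image _).bddAbove (Set.mem_image_of_mem _ hs)

theorem optRadius_le_radius {α : Type*} [MetricSpace α] {S T : Finset α} {k : ℕ}
    (hTS : T ⊆ S) (hT : T.Nonempty) (hTk : T.card ≤ k) (hkS : k ≤ S.card) :
    optRadius S k ≤ radius S T := by
  obtain ⟨T', hTT', hT'S, hcard⟩ := Finset.exists_subsuperset_card_eq hTS hTk hkS
  have hbdd : BddBelow ((fun T => radius S T) '' {T : Finset α | T ⊆ S ∧ T.card = k}) := by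
    refine ⟨0, ?_⟩
    rintro _ ⟨U, -, rfl⟩
    exact radius_nonneg S U
  calc optRadius S k ≤ radius S T' := csInf_le hbdd ⟨T', ⟨hT'S, hcard⟩, rfl⟩
    _ ≤ radius S T := radius_le (radius_nonneg S T) fun s hs =>
      (Metric.infDist_le_infDist_of_subset (Finset.coe_subset.2 hTT')
        (Finset.coe_nonempty.2 hT)).trans (infDist_le_radius T hs)

theorem le_optRadius {α : Type*} [MetricSpace α] {S : Finset α} {k : ℕ} {r : ℝ}
    (hkS : k ≤ S.card) (h : ∀ T ⊆ S, T.card = k → r ≤ radius S T) : r ≤ optRadius S k := by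
  refine le_csInf ?_ ?_
  · obtain ⟨T, hTS, hT⟩ := Finset.exists_subset_card_eq hkS
    exact ⟨_, T, ⟨hTS, hT⟩, rfl⟩
  · rintro _ ⟨T, ⟨hTS, hT⟩, rfl⟩
    exact h T hTS hT

theorem optRadius_add_le_optRadiusOut {α : Type*} [MetricSpace α] [DecidableEq α]
    {S : Finset α} {k z : ℕ} (hk : 0 < k) (hkz : k + z ≤ S.card) :
    optRadius S (k + z) ≤ optRadiusOut S k z := by
  refine le_csInf ?_ ?_
  · obtain ⟨T, hTS, hT⟩ := Finset.exists_subset_card_eq (s := S) (n := k) (by omega)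
    obtain ⟨Z, hZS, hZ⟩ := Finset.exists_subset_card_eq (s := S) (n := z) (by omega)
    exact ⟨_, T, Z, hTS, hT, hZS, hZ, rfl⟩
  · rintro _ ⟨T, Z, hTS, hT, hZS, hZ, rfl⟩
    have hTne : T.Nonempty := Finset.card_pos.1 (by omega)
    refine (optRadius_le_radius (Finset.union_subset hTS hZS) (hTne.mono Finset.subset_union_left)
      ((Finset.card_union_le T Z).trans (by omega)) hkz).trans ?_
    refine radius_le (radius_nonneg _ _) fun s hs => ?_
    by_cases hsZ : s ∈ Z
    · rw [Metric.infDist_zero_of_mem (Finset.mem_coe.2 (Finset.mem_union_right T hsZ))]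
      exact radius_nonneg _ _
    · exact (Metric.infDist_le_infDist_of_subset (Finset.coe_subset.2 Finset.subset_union_left)
        (Finset.coe_nonempty.2 hTne)).trans
        (infDist_le_radius T (Finset.mem_sdiff.2 ⟨hs, hsZ⟩))

theorem DoublingDimLE.exists_cover {α : Type*} [MetricSpace α] {D : ℕ} (hD : DoublingDimLE α D)
    (n : ℕ) (x : α) {r : ℝ} (hr : 0 < r) : ∃ Y : Finset α, Y.card ≤ 2 ^ (D * n) ∧
      ∀ s, dist s x ≤ r → ∃ y ∈ Y, dist s y ≤ r / 2 ^ n := by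
  classical
  induction n with
  | zero => exact ⟨{x}, by simp, fun s hs => ⟨x, by simp, by simpa using hs⟩⟩
  | succ n ih =>
    obtain ⟨Y, hYcard, hY⟩ := ih
    choose W hWcard hW using fun y => hD y (r / 2 ^ n) (by positivity)
    refine ⟨Y.biUnion W, ?_, fun s hs => ?_⟩
    · calc (Y.biUnion W).card ≤ Y.card * 2 ^ D :=
            Finset.card_biUnion_le_card_mul _ _ _ fun y _ => hWcard y
        _ ≤ 2 ^ (D * n) * 2 ^ D := Nat.mul_le_mul_right _ hYcard
        _ = 2 ^ (D * (n + 1)) := by rw [← pow_add, mul_add, mul_one]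
    · obtain ⟨y, hyY, hy⟩ := hY s hs
      have hs' := hW y (Metric.mem_closedBall.2 hy)
      simp only [Set.mem_iUnion, Metric.mem_closedBall, exists_prop] at hs'
      obtain ⟨w, hw, hsw⟩ := hs'
      exact ⟨w, Finset.mem_biUnion.2 ⟨y, hyY, hw⟩, by rwa [pow_succ, ← div_div]⟩

/-- Points of `S` can replace arbitrary centers at the cost of doubling the radius. -/
theorem exists_subset_centers {α : Type*} [MetricSpace α] {S Y : Finset α} {r : ℝ}
    (h : ∀ s ∈ S, ∃ y ∈ Y, dist s y ≤ r) :
    ∃ T ⊆ S, T.card ≤ Y.card ∧ ∀ s ∈ S, ∃ t ∈ T, dist s t ≤ 2 * r := by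
  classical
  let p : α → Prop := fun y => ∃ s ∈ S, dist s y ≤ r
  have hp : ∀ y : {y // p y}, ∃ s ∈ S, dist s y.1 ≤ r := fun y => y.2
  choose c hcS hc using hp
  refine ⟨(Y.subtype p).image c, ?_, ?_, fun s hs => ?_⟩
  · intro t ht
    obtain ⟨y, -, rfl⟩ := Finset.mem_image.1 ht
    exact hcS y
  · refine Finset.card_image_le.trans ?_
    rw [Finset.card_subtype]
    exact Finset.card_filter_le _ _
  · obtain ⟨y, hyY, hy⟩ := h s hs
    refine ⟨c ⟨y, s, hs, hy⟩, Finset.mem_image_of_mem c (Finset.mem_subtype.2 hyY), ?_⟩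
    have hcy := hc ⟨y, s, hs, hy⟩
    linarith [dist_triangle_right s (c ⟨y, s, hs, hy⟩) y]

theorem radius_pos {α : Type*} [MetricSpace α] {S T : Finset α} (hT : T.Nonempty)
    (hcard : T.card < S.card) : 0 < radius S T := by
  obtain ⟨s, hsS, hsT⟩ := Finset.exists_mem_notMem_of_card_lt_card hcard
  refine lt_of_lt_of_le ?_ (infDist_le_radius T hsS)
  exact (T.finite_toSet.isClosed.notMem_iff_infDist_pos (Finset.coe_nonempty.2 hT)).1
    (by simpa using hsT)

theorem optRadius_le_two_mul_radius_div {α : Type*} [MetricSpace α] {D : ℕ}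
    (hD : DoublingDimLE α D) {S T : Finset α} (hT : T.Nonempty) (hcard : T.card < S.card)
    {n τ : ℕ} (hτ : T.card * 2 ^ (D * n) ≤ τ) (hτS : τ ≤ S.card) :
    optRadius S τ ≤ 2 * (radius S T / 2 ^ n) := by
  classical
  have hr := radius_pos hT hcard
  choose W hWcard hW using fun x => hD.exists_cover n x hr
  obtain ⟨U, hUS, hUcard, hU⟩ := exists_subset_centers (S := S) (Y := T.biUnion W)
      (r := radius S T / 2 ^ n) <| by
    intro s hs
    obtain ⟨t, htT, ht⟩ := T.finite_toSet.isCompact.exists_infDist_eq_dist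
      (Finset.coe_nonempty.2 hT) s
    obtain ⟨y, hy, hsy⟩ := hW t s (ht ▸ infDist_le_radius T hs)
    exact ⟨y, Finset.mem_biUnion.2 ⟨t, htT, hy⟩, hsy⟩
  have hUne : U.Nonempty := by
    obtain ⟨s, hs⟩ := Finset.card_pos.1 (Nat.zero_lt_of_lt hcard)
    obtain ⟨t, ht, -⟩ := hU s hs
    exact ⟨t, ht⟩
  have hUτ : U.card ≤ τ :=
    (hUcard.trans (Finset.card_biUnion_le_card_mul _ _ _ fun x _ => hWcard x)).trans hτ
  refine (optRadius_le_radius hUS hUne hUτ hτS).trans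
    (radius_le (by positivity) fun s hs => ?_)
  obtain ⟨t, ht, hst⟩ := hU s hs
  exact (Metric.infDist_le_dist_of_mem (Finset.mem_coe.2 ht)).trans hst

/-- Lemma 4.2, first part: in a space of doubling dimension at
most `D`, for any `τ ≥ (k+z)·2^(D·⌈log₂(16/ε̂)⌉)` (and `τ < |S|`) we have
`r_τ^*(S) ≤ (ε̂/8)·r_{k+z}^*(S) ≤ (ε̂/8)·r_{k,z}^*(S)`. -/
theorem streaming_coreset_radius {α : Type*} [MetricSpace α] [DecidableEq α]
    (D : ℕ) (hD : DoublingDimLE α D)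
    (S : Finset α) (k z : ℕ) (hk : 0 < k) (hz : 0 < z) (hkz : k + z < S.card)
    (εh : ℝ) (hεh : 0 < εh) (hεh1 : εh ≤ 1)
    (τ : ℕ) (hτl : (k + z) * 2 ^ (D * ⌈Real.logb 2 (16 / εh)⌉₊) ≤ τ)
    (hτu : τ < S.card) :
    optRadius S τ ≤ εh / 8 * optRadius S (k + z) ∧
    optRadius S τ ≤ εh / 8 * optRadiusOut S k z := by
  have main : optRadius S τ ≤ εh / 8 * optRadius S (k + z) := by
    rw [← div_le_iff₀' (by positivity)]
    refine le_optRadius hkz.le fun T hTS hT => ?_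
    rw [div_le_iff₀' (by positivity)]
    refine (optRadius_le_two_mul_radius_div hD (Finset.card_pos.1 (by omega)) (hT ▸ hkz)
      (hT ▸ hτl) hτu.le).trans ?_
    have hpow : 16 / εh ≤ 2 ^ ⌈Real.logb 2 (16 / εh)⌉₊ := by
      rw [← Real.rpow_natCast, ← Real.logb_le_iff_le_rpow one_lt_two (by positivity)]
      exact Nat.le_ceil _
    calc 2 * (radius S T / 2 ^ ⌈Real.logb 2 (16 / εh)⌉₊)
        ≤ 2 * (radius S T / (16 / εh)) := by
          gcongr
          exact radius_nonneg S T
      _ = εh / 8 * radius S T := by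
          field_simp
          ring
  exact ⟨main, main.trans
    (mul_le_mul_of_nonneg_left (optRadius_add_le_optRadiusOut hk hkz.le) (by positivity))⟩
end
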